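/- If ρ ∈ Ob T is irreducible, then ρ maps the center Z bijectively onto itself, i.e. the restriction λ := ρ|Z is a *-automorphism of Z; consequently a proper inclusion Z ⊊ ρ(Z) cannot occur for irreducible ρ. -/

import Mathlib

open scoped BigOperators

namespace DR

variable {A : Type*} [NormedRing A] [StarRing A] [CStarRing A]
  [NormedAlgebra ℂ A] [StarModule ℂ A] [CompleteSpace A]

/-- The intertwiner space `(α,β) = {X ∈ A : X α(a) = β(a) X for all a}`. -/
def Intertwiner (α β : A →⋆ₐ[ℂ] A) : Set A :=
  {X : A | ∀ a : A, X * α a = β a * X}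

/-- `ρ` is irreducible if `(ρ,ρ) = Z`, the center of `A`. -/
def IsIrreducible (ρ : A →⋆ₐ[ℂ] A) : Prop :=
  Intertwiner ρ ρ = Set.center A

/-- `α` and `β` are unitarily equivalent if there is a unitary in `(α,β)`. -/
def UnitarilyEquivalent (α β : A →⋆ₐ[ℂ] A) : Prop :=
  ∃ U : A, U ∈ Intertwiner α β ∧ star U * U = 1 ∧ U * star U = 1

/-- The data of an endomorphism category `T` of a unital C*-algebra `A`,
together with a distinguished DR-subcategory `T_ℂ`, a permutation structure `ε`
and a conjugation structure `(conj, R, S)`, satisfying the postulates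
(P.1.1)--(P.1.3), (P.2.1)--(P.2.7), (P.3.1)--(P.3.4) and (P.4.1)--(P.4.2). -/
structure DRData (A : Type*) [NormedRing A] [StarRing A] [CStarRing A]
    [NormedAlgebra ℂ A] [StarModule ℂ A] [CompleteSpace A] where
  /-- the objects: a set of unital *-endomorphisms of `A` -/
  Ob : Set (A →⋆ₐ[ℂ] A)
  id_mem : StarAlgHom.id ℂ A ∈ Ob
  comp_mem : ∀ α ∈ Ob, ∀ β ∈ Ob, α.comp β ∈ Ob
  /-- (P.1.1) closedness under direct sums -/
  P11 : ∀ α ∈ Ob, ∀ β ∈ Ob, ∃ γ ∈ Ob, ∃ V W : A,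
    V ∈ Intertwiner α γ ∧ W ∈ Intertwiner β γ ∧
    star V * V = 1 ∧ star W * W = 1 ∧ star V * W = 0 ∧
    V * star V + W * star W = 1 ∧
    ∀ a : A, γ a = V * α a * star V + W * β a * star W
  /-- (P.1.2) closedness under subobjects -/
  P12 : ∀ α ∈ Ob, ∀ β : A →⋆ₐ[ℂ] A, ∀ V : A,
    V ∈ Intertwiner β α → star V * V = 1 → β ∈ Ob
  /-- (P.1.3) closedness under complementary subobjects -/
  P13 : ∀ α ∈ Ob, ∀ β ∈ Ob, ∀ V : A, V ∈ Intertwiner β α → star V * V = 1 →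
    ∃ β' ∈ Ob, ∃ W : A, W ∈ Intertwiner β' α ∧ star W * W = 1 ∧
    star V * W = 0 ∧ V * star V + W * star W = 1 ∧
    ∀ a : A, α a = V * β a * star V + W * β' a * star W
  /-- the distinguished intertwiner subspaces `(α,β)_ℂ` -/
  CC : (A →⋆ₐ[ℂ] A) → (A →⋆ₐ[ℂ] A) → Submodule ℂ A
  /-- `(α,β)_ℂ` is norm-closed -/
  CC_closed : ∀ α ∈ Ob, ∀ β ∈ Ob, IsClosed (CC α β : Set A)
  /-- `(α,β)_ℂ ⊆ (α,β)` -/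
  CC_le : ∀ α ∈ Ob, ∀ β ∈ Ob, (CC α β : Set A) ⊆ Intertwiner α β
  /-- (P.2.1) -/
  P21 : ∀ α ∈ Ob, ∀ β ∈ Ob, ∀ γ ∈ Ob, ∀ X ∈ CC β γ, ∀ Y ∈ CC α β, X * Y ∈ CC α γ
  /-- (P.2.2) -/
  P22 : ∀ α ∈ Ob, ∀ β ∈ Ob, ∀ γ ∈ Ob, ∀ X ∈ CC β γ,
    α X ∈ CC (α.comp β) (α.comp γ)
  /-- (P.2.3) -/
  P23 : ∀ α ∈ Ob, ∀ β ∈ Ob, ∀ γ ∈ Ob, ∀ X ∈ CC α β, X ∈ CC (α.comp γ) (β.comp γ)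
  /-- (P.2.4) -/
  P24 : ∀ α ∈ Ob, ∀ β ∈ Ob, ∀ X ∈ CC α β, star X ∈ CC β α
  /-- (P.2.5) `(ι,ι)_ℂ = ℂ·1` -/
  P25 : (CC (StarAlgHom.id ℂ A) (StarAlgHom.id ℂ A) : Set A)
          = {x : A | ∃ c : ℂ, x = c • (1 : A)}
  /-- (P.2.6) linear independence modulo `α(Z)` -/
  P26_indep : ∀ α ∈ Ob, ∀ β ∈ Ob, ∀ n : ℕ, ∀ F : Fin n → A,
    (∀ j, F j ∈ CC α β) → LinearIndependent ℂ F →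
    ∀ Zc : Fin n → A, (∀ j, Zc j ∈ Set.center A) →
    (∑ j : Fin n, F j * α (Zc j)) = 0 → ∀ j, α (Zc j) = 0
  /-- (P.2.6) `(α,β) = (α,β)_ℂ · α(Z)` -/
  P26_gen : ∀ α ∈ Ob, ∀ β ∈ Ob, ∀ X ∈ Intertwiner α β,
    ∃ n : ℕ, ∃ F Zc : Fin n → A, (∀ j, F j ∈ CC α β) ∧
      (∀ j, Zc j ∈ Set.center A) ∧ X = ∑ j : Fin n, F j * α (Zc j)
  /-- (P.2.7) `T_ℂ` is closed under direct sums -/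
  P27_dsum : ∀ α ∈ Ob, ∀ β ∈ Ob, ∃ γ ∈ Ob, ∃ V W : A,
    V ∈ CC α γ ∧ W ∈ CC β γ ∧ star V * V = 1 ∧ star W * W = 1 ∧
    star V * W = 0 ∧ V * star V + W * star W = 1 ∧
    ∀ a : A, γ a = V * α a * star V + W * β a * star W
  /-- (P.2.7) `T_ℂ` is closed under subobjects -/
  P27_sub : ∀ α ∈ Ob, ∀ β : A →⋆ₐ[ℂ] A, ∀ V : A,
    V ∈ CC β α → star V * V = 1 → β ∈ Ob
  /-- (P.2.7) `T_ℂ` is closed under complementary subobjects -/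
  P27_comp : ∀ α ∈ Ob, ∀ β ∈ Ob, ∀ V : A, V ∈ CC β α → star V * V = 1 →
    ∃ β' ∈ Ob, ∃ W : A, W ∈ CC β' α ∧ star W * W = 1 ∧ star V * W = 0 ∧
    V * star V + W * star W = 1 ∧
    ∀ a : A, α a = V * β a * star V + W * β' a * star W
  /-- (P.3) the permutators `ε(α,β)` -/
  eps : (A →⋆ₐ[ℂ] A) → (A →⋆ₐ[ℂ] A) → A
  eps_mem : ∀ α ∈ Ob, ∀ β ∈ Ob, eps α β ∈ CC (α.comp β) (β.comp α)
  eps_unitary : ∀ α ∈ Ob, ∀ β ∈ Ob,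
    star (eps α β) * eps α β = 1 ∧ eps α β * star (eps α β) = 1
  /-- (P.3.1) -/
  P31 : ∀ α ∈ Ob, ∀ β ∈ Ob, eps α β * eps β α = 1
  /-- (P.3.2) -/
  P32 : ∀ α ∈ Ob, eps (StarAlgHom.id ℂ A) α = 1 ∧ eps α (StarAlgHom.id ℂ A) = 1
  /-- (P.3.3) -/
  P33 : ∀ α ∈ Ob, ∀ β ∈ Ob, ∀ γ ∈ Ob,
    eps (α.comp β) γ = eps α γ * α (eps β γ)
  /-- (P.3.4) the flip property for intertwiners in `T_ℂ` -/
  P34 : ∀ α ∈ Ob, ∀ α' ∈ Ob, ∀ β ∈ Ob, ∀ β' ∈ Ob, ∀ X ∈ CC α α', ∀ Y ∈ CC β β',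
    eps α' β' * (X * α Y) = (Y * β X) * eps α β
  /-- (P.4) the conjugate `ᾱ` -/
  conj : (A →⋆ₐ[ℂ] A) → (A →⋆ₐ[ℂ] A)
  conj_mem : ∀ α ∈ Ob, conj α ∈ Ob
  /-- (P.4) `R_α ∈ (ι,ᾱα)_ℂ` -/
  R : (A →⋆ₐ[ℂ] A) → A
  /-- (P.4) `S_α ∈ (ι,αᾱ)_ℂ` -/
  S : (A →⋆ₐ[ℂ] A) → A
  R_mem : ∀ α ∈ Ob, R α ∈ CC (StarAlgHom.id ℂ A) ((conj α).comp α)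
  S_mem : ∀ α ∈ Ob, S α ∈ CC (StarAlgHom.id ℂ A) (α.comp (conj α))
  /-- (P.4.1) -/
  P41 : ∀ α ∈ Ob, star (S α) * α (R α) = 1 ∧ star (R α) * (conj α) (S α) = 1
  /-- (P.4.2) -/
  P42 : ∀ α ∈ Ob, S α = eps (conj α) α * R α


namespace DRData

theorem one_mem_CC (dd : DRData A) {α : A →⋆ₐ[ℂ] A} (hα : α ∈ dd.Ob) :
    (1 : A) ∈ dd.CC α α := by
  have h : (1 : A) ∈ (dd.CC (StarAlgHom.id ℂ A) (StarAlgHom.id ℂ A) : Set A) := by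
    rw [dd.P25]
    exact ⟨1, (one_smul ℂ 1).symm⟩
  simpa using dd.P23 _ dd.id_mem _ dd.id_mem α hα 1 h

/-- Objects with a conjugate are injective endomorphisms. -/
theorem injective_of_mem (dd : DRData A) {α : A →⋆ₐ[ℂ] A} (hα : α ∈ dd.Ob) :
    Function.Injective α := by
  have hmem := dd.comp_mem _ (dd.conj_mem α hα) _ hα
  have hR := dd.R_mem α hα
  obtain ⟨c, hc⟩ : star (dd.R α) * dd.R α ∈ {x : A | ∃ c : ℂ, x = c • (1 : A)} := by
    rw [← dd.P25]
    exact dd.P21 _ dd.id_mem _ hmem _ dd.id_mem _ (dd.P24 _ dd.id_mem _ hmem _ hR) _ hR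
  refine (injective_iff_map_eq_zero α).2 fun a ha => ?_
  have hRa : dd.R α * a = 0 := by
    have h := dd.CC_le _ dd.id_mem _ hmem hR a
    simpa [ha] using h
  rcases eq_or_ne c 0 with rfl | hc0
  · have hR0 : dd.R α = 0 := by
      rw [zero_smul] at hc
      exact CStarRing.star_mul_self_eq_zero_iff _ |>.1 hc
    have h10 : (0 : A) = 1 := by simpa [hR0] using (dd.P41 α hα).1
    rw [← one_mul a, ← h10, zero_mul]
  · have h : c • a = 0 := by
      rw [← one_mul a, ← smul_mul_assoc, ← hc, mul_assoc, hRa, mul_zero]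
    exact (smul_eq_zero.1 h).resolve_left hc0

/-- A central element of `(α,α)_ℂ` is fixed by `α`, by the flip property of `ε(α,α)`. -/
theorem map_eq_self_of_mem_center (dd : DRData A) {α : A →⋆ₐ[ℂ] A} (hα : α ∈ dd.Ob)
    {F : A} (hF : F ∈ dd.CC α α) (hFc : F ∈ Set.center A) : α F = F := by
  have h := dd.P34 _ hα _ hα _ hα _ hα F hF 1 (dd.one_mem_CC hα)
  rw [map_one, mul_one, one_mul, ← (Set.mem_center_iff.1 hFc).comm] at h
  have h' := congrArg (· * star (dd.eps α α)) h
  simp only [mul_assoc, (dd.eps_unitary α hα α hα).2, mul_one] at h'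
  exact h'.symm

end DRData

omit [CStarRing A] [StarModule ℂ A] [CompleteSpace A] in
theorem IsIrreducible.mapsTo_center {ρ : A →⋆ₐ[ℂ] A}
    (hirr : IsIrreducible ρ) : Set.MapsTo ρ (Set.center A) (Set.center A) := by
  intro z hz
  rw [← hirr]
  intro a
  rw [← map_mul, ← map_mul, (Set.mem_center_iff.1 hz).comm a]

/-- If `ρ ∈ Ob T` is irreducible, then `ρ` maps the center `Z` bijectively
onto itself, i.e. `ρ|Z` is a *-automorphism of `Z`; in particular
`ρ(Z) = Z`, so a proper inclusion `Z ⊊ ρ(Z)` cannot occur. -/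
theorem irreducible_restricts_to_center_automorphism (dd : DRData A)
    (ρ : A →⋆ₐ[ℂ] A) (hρ : ρ ∈ dd.Ob) (hirr : IsIrreducible ρ) :
    Set.BijOn ρ (Set.center A) (Set.center A) ∧
      ρ '' Set.center A = Set.center A := by
  have hsurj : Set.SurjOn ρ (Set.center A) (Set.center A) := by
    intro X hX
    obtain ⟨n, F, Zc, hF, hZ, rfl⟩ := dd.P26_gen ρ hρ ρ hρ X (by rw [hirr]; exact hX)
    have hFc (j : Fin n) : F j ∈ Set.center A := by
      rw [← hirr]
      exact dd.CC_le ρ hρ ρ hρ (hF j)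
    refine ⟨∑ j, F j * Zc j,
      sum_mem (S := Subring.center A) fun j _ => Set.mul_mem_center (hFc j) (hZ j), ?_⟩
    simp only [map_sum, map_mul, dd.map_eq_self_of_mem_center hρ (hF _) (hFc _)]
  have hbij : Set.BijOn ρ (Set.center A) (Set.center A) :=
    ⟨hirr.mapsTo_center, (dd.injective_of_mem hρ).injOn, hsurj⟩
  exact ⟨hbij, hbij.image_eq⟩

end DR
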